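/- Let R be a commutative ring, I an injective R-module, and ι : R → I an injective R-linear map. For an R-module A, let A⁺ = Hom_ℤ(A, ℚ/ℤ) denote the character module of A, an R-module via (r • f)(a) = f(r • a). Then the restriction map A⁺ → (s(A))⁺ is surjective, and its kernel equals the trace Tr(I, A⁺) of the injective R-modules in A⁺; consequently (s(A))⁺ ≅ q(A⁺), i.e., the character module of the torsion of A is isomorphic to the cotorsion of the character module of A. -/

import Mathlib

open scoped TensorProduct

universe u

/-- The trace of the class of injective `R`-modules in an `R`-module `C`:
the supremum of the ranges of all linear maps from injective modules to `C`. -/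
def injectiveTrace (R : Type u) [Ring R] (C : Type u) [AddCommGroup C] [Module R C] :
    Submodule R C :=
  sSup {p : Submodule R C | ∃ (J : Type u) (_ : AddCommGroup J) (_ : Module R J),
    Module.Injective R J ∧ ∃ h : J →ₗ[R] C, p = LinearMap.range h}

/-- The range of the dual of a linear map `f` is the annihilator of the kernel of `f`. -/
lemma CharacterModule.range_dual_eq_ker_dual_subtype {R : Type*} [CommRing R] {M N : Type*}
    [AddCommGroup M] [Module R M] [AddCommGroup N] [Module R N] (f : M →ₗ[R] N) :
    LinearMap.range (CharacterModule.dual f) =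
      LinearMap.ker (CharacterModule.dual (LinearMap.ker f).subtype) := by
  apply le_antisymm
  · rintro _ ⟨g, rfl⟩
    rw [LinearMap.mem_ker]
    ext x
    change g (f x.1) = 0
    rw [LinearMap.mem_ker.mp x.2, map_zero]
  · intro c hc
    have hker : (LinearMap.ker f).toAddSubgroup ≤ AddMonoidHom.ker c := fun x hx =>
      AddMonoidHom.mem_ker.mpr (DFunLike.congr_fun (LinearMap.mem_ker.mp hc) ⟨x, hx⟩)
    let c' : CharacterModule (M ⧸ LinearMap.ker f) :=
      QuotientAddGroup.lift (LinearMap.ker f).toAddSubgroup c hker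
    obtain ⟨g, hg⟩ := CharacterModule.dual_surjective_of_injective
      ((LinearMap.ker f).liftQ f le_rfl)
      (LinearMap.ker_eq_bot.mp (Submodule.ker_liftQ_eq_bot _ _ _ le_rfl)) c'
    refine ⟨g, ?_⟩
    ext x
    exact DFunLike.congr_fun hg (Submodule.Quotient.mk x)

/-- The annihilator of the kernel of `a ↦ a ⊗ₜ i` consists of the values at `i` of linear maps
into the character module. -/
lemma CharacterModule.mem_ker_dual_subtype_ker_mk_flip_iff {R : Type*} [CommRing R]
    {A I : Type*} [AddCommGroup A] [Module R A] [AddCommGroup I] [Module R I] (i : I)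
    (c : CharacterModule A) :
    c ∈ LinearMap.ker
        (CharacterModule.dual (LinearMap.ker ((TensorProduct.mk R A I).flip i)).subtype) ↔
      ∃ h : I →ₗ[R] CharacterModule A, h i = c := by
  rw [← CharacterModule.range_dual_eq_ker_dual_subtype]
  constructor
  · rintro ⟨g, rfl⟩
    exact ⟨CharacterModule.curry
      (CharacterModule.dual (TensorProduct.comm R I A).toLinearMap g), rfl⟩
  · rintro ⟨h, rfl⟩
    exact ⟨CharacterModule.dual (TensorProduct.comm R A I).toLinearMap
      (CharacterModule.uncurry h), rfl⟩

/-- The trace of the injective modules in `C` consists of the values at `ι 1` of linear maps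
`I → C`, where `ι` embeds `R` into the injective module `I`. -/
lemma mem_injectiveTrace_iff {R : Type u} [CommRing R] {I : Type u} [AddCommGroup I] [Module R I]
    (hI : Module.Injective R I) (ι : R →ₗ[R] I) (hι : Function.Injective ι)
    {C : Type u} [AddCommGroup C] [Module R C] (c : C) :
    c ∈ injectiveTrace R C ↔ ∃ h : I →ₗ[R] C, h (ι 1) = c := by
  constructor
  · suffices h : injectiveTrace R C ≤ LinearMap.range (LinearMap.applyₗ (R := R) (M₂ := C) (ι 1)) by
      exact fun hc => h hc
    apply sSup_le
    rintro _ ⟨J, _, _, hJ, h, rfl⟩ _ ⟨j, rfl⟩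
    obtain ⟨k, hk⟩ := hJ.out ι hι (LinearMap.toSpanSingleton R J j)
    exact ⟨h ∘ₗ k, by simp [hk]⟩
  · rintro ⟨h, rfl⟩
    exact (le_sSup ⟨I, _, _, hI, h, rfl⟩ : LinearMap.range h ≤ injectiveTrace R C) ⟨ι 1, rfl⟩

/-- Let `I` be an injective module with an injective linear map `ι : R → I`.  For any module
`A`, with `A⁺ = Hom_ℤ(A, ℚ/ℤ)` the character module (an `R`-module via `(r • f) a = f (r • a)`),
the restriction map `A⁺ → (s(A))⁺` is surjective with kernel the trace of the injective
`R`-modules in `A⁺`; consequently `(s(A))⁺ ≅ q(A⁺)`: the character module of the torsion of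
`A` is the cotorsion of the character module of `A`. -/
theorem characterModule_torsion_iso_cotorsion_characterModule
    {R : Type u} [CommRing R]
    {I : Type u} [AddCommGroup I] [Module R I]
    (hI : Module.Injective R I) (ι : R →ₗ[R] I) (hι : Function.Injective ι)
    (A : Type u) [AddCommGroup A] [Module R A] :
    Function.Surjective
        (CharacterModule.dual
          (LinearMap.ker ((TensorProduct.mk R A I).flip (ι 1))).subtype) ∧
      LinearMap.ker
          (CharacterModule.dual
            (LinearMap.ker ((TensorProduct.mk R A I).flip (ι 1))).subtype) =
        injectiveTrace R (CharacterModule A) ∧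
      Nonempty
        (CharacterModule ↥(LinearMap.ker ((TensorProduct.mk R A I).flip (ι 1))) ≃ₗ[R]
          (CharacterModule A ⧸ injectiveTrace R (CharacterModule A))) := by
  have hsurj := CharacterModule.dual_surjective_of_injective
    (LinearMap.ker ((TensorProduct.mk R A I).flip (ι 1))).subtype (Submodule.subtype_injective _)
  have hker : LinearMap.ker (CharacterModule.dual
      (LinearMap.ker ((TensorProduct.mk R A I).flip (ι 1))).subtype) =
        injectiveTrace R (CharacterModule A) := by
    ext c
    rw [CharacterModule.mem_ker_dual_subtype_ker_mk_flip_iff, mem_injectiveTrace_iff hI ι hι]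
  exact ⟨hsurj, hker, ⟨((Submodule.quotEquivOfEq _ _ hker.symm).trans
    (LinearMap.quotKerEquivOfSurjective _ hsurj)).symm⟩⟩
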